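/- Let G = (V, E) be a digraph rooted at v, let u ∈ V with D = dom_G(u), and let C be a directed cycle in G that uses no edge entering u from outside D other than edges in G(D → u) (equivalently, consider any choice of edges with at most one incoming edge per vertex, the edge into u chosen among edges from V∖D). Then every directed cycle of G either lies entirely within the induced subdigraph G[D∖{u}] (and hence is a cycle of root_u(G[D])), or corresponds to a directed cycle of the contracted digraph G(D → u). -/

import Mathlib

open MvPolynomial

/-- A finite directed (multi)graph with abstractly named edges: a finite set of
vertices, a finite set of edge names, and source/target maps.  Edge names double
as the labels/variables of the Kirchhoff polynomial. -/
structure MultiDigraph (V : Type*) (ε : Type*) where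
  verts : Finset V
  edges : Finset ε
  src : ε → V
  tgt : ε → V

namespace MultiDigraph

variable {V : Type*} {ε : Type*} [DecidableEq V] [DecidableEq ε]

/-- One step along an edge of `A`. -/
def Step (G : MultiDigraph V ε) (A : Finset ε) (x y : V) : Prop :=
  ∃ e ∈ A, G.src e = x ∧ G.tgt e = y

/-- Directed reachability using only edges of `A`. -/
def Reaches (G : MultiDigraph V ε) (A : Finset ε) (x y : V) : Prop :=
  Relation.ReflTransGen (G.Step A) x y

/-- Every edge has both of its endpoints among the vertices. -/
def WellFormed (G : MultiDigraph V ε) : Prop :=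
  ∀ e ∈ G.edges, G.src e ∈ G.verts ∧ G.tgt e ∈ G.verts

/-- `G` is a simple digraph: it has no loops and no parallel edges. -/
def Simple (G : MultiDigraph V ε) : Prop :=
  (∀ e ∈ G.edges, G.src e ≠ G.tgt e) ∧
    ∀ e ∈ G.edges, ∀ e' ∈ G.edges, G.src e = G.src e' → G.tgt e = G.tgt e' → e = e'

/-- `A` is (the edge set of) an arborescence of `G` rooted at `r`: a spanning
subdigraph in which every vertex other than the root has exactly one incoming
edge, the root has none, and every vertex is reachable from the root (hence
along a unique directed path). -/
def IsArbAt (G : MultiDigraph V ε) (A : Finset ε) (r : V) : Prop :=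
  A ⊆ G.edges ∧ r ∈ G.verts ∧
  (∀ e ∈ A, G.src e ∈ G.verts ∧ G.tgt e ∈ G.verts) ∧
  (∀ e ∈ A, G.tgt e ≠ r) ∧
  (∀ w ∈ G.verts, w ≠ r → ∃! e, e ∈ A ∧ G.tgt e = w) ∧
  (∀ w ∈ G.verts, G.Reaches A r w)

/-- `A` is an arborescence of `G` (rooted at some vertex). -/
def IsArb (G : MultiDigraph V ε) (A : Finset ε) : Prop :=
  ∃ r, G.IsArbAt A r

open Classical in
/-- The Kirchhoff polynomial of `G`: the sum, over all arborescences, of the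
products of the variables of their edges. -/
noncomputable def kirchhoff (G : MultiDigraph V ε) : MvPolynomial ε ℚ :=
  ∑ A ∈ G.edges.powerset.filter (fun A => G.IsArb A), ∏ e ∈ A, X e

open Classical in
/-- The Kirchhoff polynomial of arborescences of `G` rooted at `r`. -/
noncomputable def kirchhoffAt (G : MultiDigraph V ε) (r : V) : MvPolynomial ε ℚ :=
  ∑ A ∈ G.edges.powerset.filter (fun A => G.IsArbAt A r), ∏ e ∈ A, X e

/-- The incoming edges of vertex `v`. -/
def inEdges (G : MultiDigraph V ε) (v : V) : Finset ε :=
  G.edges.filter (fun e => G.tgt e = v)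

/-- `G` is rooted at `v`: `v` has no incoming edges and every vertex is
reachable from `v`. -/
def RootedAt (G : MultiDigraph V ε) (v : V) : Prop :=
  v ∈ G.verts ∧ (∀ e ∈ G.edges, G.tgt e ≠ v) ∧ ∀ w ∈ G.verts, G.Reaches G.edges v w

/-- `G` is strongly connected. -/
def StronglyConnected (G : MultiDigraph V ε) : Prop :=
  ∀ x ∈ G.verts, ∀ y ∈ G.verts, G.Reaches G.edges x y

/-- `G` is (weakly) connected. -/
def WeaklyConnected (G : MultiDigraph V ε) : Prop :=
  ∀ x ∈ G.verts, ∀ y ∈ G.verts,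
    Relation.ReflTransGen (fun a b => G.Step G.edges a b ∨ G.Step G.edges b a) x y

/-- The induced subdigraph `G[D]`. -/
def induce (G : MultiDigraph V ε) (D : Finset V) : MultiDigraph V ε where
  verts := D
  edges := G.edges.filter (fun e => G.src e ∈ D ∧ G.tgt e ∈ D)
  src := G.src
  tgt := G.tgt

/-- `root_u(G)`: remove all edges incoming to `u`. -/
def rootAt (G : MultiDigraph V ε) (u : V) : MultiDigraph V ε where
  verts := G.verts
  edges := G.edges.filter (fun e => G.tgt e ≠ u)
  src := G.src
  tgt := G.tgt

/-- Delete a single edge. -/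
def deleteEdge (G : MultiDigraph V ε) (e₀ : ε) : MultiDigraph V ε where
  verts := G.verts
  edges := G.edges.erase e₀
  src := G.src
  tgt := G.tgt

/-- The contraction `G(S → u)`: all edges from `Vᶜ∖S` into `S∖{u}` and all edges
inside `S` are removed, and `S` is contracted into the single vertex `u`;
edges retain their names (labels). -/
def contract (G : MultiDigraph V ε) (S : Finset V) (u : V) : MultiDigraph V ε where
  verts := insert u (G.verts \ S)
  edges := G.edges.filter (fun e => G.tgt e ∉ S ∨ (G.src e ∉ S ∧ G.tgt e = u))
  src := fun e => if G.src e ∈ S then u else G.src e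
  tgt := fun e => if G.tgt e ∈ S then u else G.tgt e

/-- Directed walks from `x` to `y`, given as lists of edges taken from `A`. -/
def IsWalk (G : MultiDigraph V ε) (A : Finset ε) : List ε → V → V → Prop
  | [], x, y => x = y
  | e :: p, x, y => e ∈ A ∧ G.src e = x ∧ IsWalk G A p (G.tgt e) y

/-- A simple directed path from `x` to `y` (no repeated vertices). -/
def IsPath (G : MultiDigraph V ε) (A : Finset ε) (p : List ε) (x y : V) : Prop :=
  G.IsWalk A p x y ∧ (x :: p.map G.tgt).Nodup

/-- A simple directed cycle through `x` (no repeated vertices). -/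
def IsCycle (G : MultiDigraph V ε) (A : Finset ε) (p : List ε) (x : V) : Prop :=
  p ≠ [] ∧ G.IsWalk A p x x ∧ (p.map G.tgt).Nodup

/-- The edge set `A` contains no directed cycle. -/
def Acyclic (G : MultiDigraph V ε) (A : Finset ε) : Prop :=
  ¬ ∃ p x, G.IsCycle A p x

/-- In `G` rooted at `v`, vertex `u` dominates vertex `w`: every directed path
from `v` to `w` passes through `u`. -/
def Dominates (G : MultiDigraph V ε) (v u w : V) : Prop :=
  ∀ p : List ε, G.IsPath G.edges p v w → u ∈ v :: p.map G.tgt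

open Classical in
/-- `dom_G(u)` (w.r.t. the root `v`): the set of all vertices dominated by `u`. -/
noncomputable def domSet (G : MultiDigraph V ε) (v u : V) : Finset V :=
  G.verts.filter (fun w => G.Dominates v u w)

/-- In `G` rooted at `v`, `y` is an immediate dominator of `z`. -/
def ImmDominates (G : MultiDigraph V ε) (v y z : V) : Prop :=
  y ≠ z ∧ G.Dominates v y z ∧
    ∀ x ∈ G.verts, x ≠ y → x ≠ z → G.Dominates v x z → G.Dominates v x y

open Classical in
/-- `imm_G(y)` (w.r.t. the root `v`): the set of vertices immediately dominated by `y`. -/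
noncomputable def immSet (G : MultiDigraph V ε) (v y : V) : Finset V :=
  G.verts.filter (fun z => G.ImmDominates v y z)

open Classical in
/-- The simultaneous contraction `G(dom(z₁) → z₁; …; dom(z_i) → z_i)` for
`Z = {z₁, …, z_i}` (domination w.r.t. the root `v`). -/
noncomputable def domContract (G : MultiDigraph V ε) (v : V) (Z : Finset V) :
    MultiDigraph V ε where
  verts := G.verts.filter (fun x => ∀ z ∈ Z, G.Dominates v z x → x = z)
  edges := G.edges.filter (fun e =>
    (∀ z ∈ Z, ¬(G.Dominates v z (G.src e) ∧ G.Dominates v z (G.tgt e))) ∧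
    (∀ z ∈ Z, ¬(¬ G.Dominates v z (G.src e) ∧ G.Dominates v z (G.tgt e) ∧ G.tgt e ≠ z)))
  src := fun e =>
    if h : ∃ z ∈ Z, G.Dominates v z (G.src e) ∧ G.src e ≠ z then h.choose else G.src e
  tgt := fun e =>
    if h : ∃ z ∈ Z, G.Dominates v z (G.tgt e) ∧ G.tgt e ≠ z then h.choose else G.tgt e

/-- Mutual directed reachability in `G`. -/
def MutuallyReachable (G : MultiDigraph V ε) (x y : V) : Prop :=
  G.Reaches G.edges x y ∧ G.Reaches G.edges y x

open Classical in
/-- `W` is (the vertex set of) a strongly connected component of `G`, i.e. an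
equivalence class of mutual reachability. -/
def IsSCC (G : MultiDigraph V ε) (W : Finset V) : Prop :=
  ∃ x ∈ G.verts, W = G.verts.filter (fun y => G.MutuallyReachable x y)

/-- `W` is a minimal element in the partial order that reachability induces on
the strongly connected components of `G` (an initial SCC). -/
def IsMinimalSCC (G : MultiDigraph V ε) (W : Finset V) : Prop :=
  G.IsSCC W ∧ ∀ W', G.IsSCC W' → (∃ x ∈ W', ∃ y ∈ W, G.Reaches G.edges x y) → W' = W

open Classical in
/-- The digraph `Ĝ(W)` associated with a strongly connected component `G[W]`:
if `G[W]` has no incoming edges (it is the initial SCC) it is `G[W]` itself;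
otherwise a new auxiliary vertex (here `none`) is added and every edge of `G`
entering `W` from outside is redirected to start at the auxiliary vertex,
keeping its label. -/
noncomputable def hatSCC (G : MultiDigraph V ε) (W : Finset V) :
    MultiDigraph (Option V) ε where
  verts :=
    if ∃ e ∈ G.edges, G.tgt e ∈ W ∧ G.src e ∉ W then insert none (W.image some)
    else W.image some
  edges := G.edges.filter (fun e => G.tgt e ∈ W)
  src := fun e => if G.src e ∈ W then some (G.src e) else none
  tgt := fun e => some (G.tgt e)

/-- `u` is an independent vertex of the simple directed cycle `C` (w.r.t. the
root `v`): `u` lies on `C` and there is a simple directed path from `v` to `u`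
which is vertex-disjoint from `C` except at `u`. -/
def IsIndependentVertex (G : MultiDigraph V ε) (v : V) (C : List ε) (u : V) : Prop :=
  u ∈ C.map G.tgt ∧ ∃ p, G.IsPath G.edges p v u ∧
    ∀ z ∈ v :: p.map G.tgt, z ∈ C.map G.tgt → z = u

end MultiDigraph

open MvPolynomial

variable {V : Type*} {ε : Type*} [DecidableEq V] [DecidableEq ε]

namespace MultiDigraph

section Walks

variable {V : Type*} {ε : Type*} {G : MultiDigraph V ε} {A B : Finset ε}

theorem IsWalk.append_edge {p : List ε} {x y : V} {e : ε} (h : G.IsWalk A p x y)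
    (he : e ∈ A) (hsrc : G.src e = y) : G.IsWalk A (p ++ [e]) x (G.tgt e) := by
  induction p generalizing x with
  | nil =>
    obtain rfl : x = y := h
    exact ⟨he, hsrc, rfl⟩
  | cons a p ih => exact ⟨h.1, h.2.1, ih h.2.2⟩

/-- A walk can be truncated at any vertex it visits. -/
theorem IsWalk.exists_prefix {p : List ε} {x y z : V} (h : G.IsWalk A p x y)
    (hz : z ∈ x :: p.map G.tgt) : ∃ q, q <+: p ∧ G.IsWalk A q x z := by
  induction p generalizing x with
  | nil =>
    obtain rfl : z = x := by simpa using hz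
    exact ⟨[], List.prefix_rfl, rfl⟩
  | cons a p ih =>
    rcases List.mem_cons.1 hz with rfl | hz
    · exact ⟨[], List.nil_prefix, rfl⟩
    · obtain ⟨q, hq, hw⟩ := ih h.2.2 (by simpa using hz)
      exact ⟨a :: q, List.cons_prefix_cons.2 ⟨rfl, hq⟩, h.1, h.2.1, hw⟩

theorem IsWalk.subset {p : List ε} {x y : V} (h : G.IsWalk A p x y) : ∀ e ∈ p, e ∈ A := by
  induction p generalizing x with
  | nil => simp
  | cons a p ih => exact List.forall_mem_cons.2 ⟨h.1, ih h.2.2⟩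

theorem IsWalk.mono {H : MultiDigraph V ε} {p : List ε} {x y : V} (h : G.IsWalk A p x y)
    (hsrc : H.src = G.src) (htgt : H.tgt = G.tgt) (hB : ∀ e ∈ p, e ∈ B) :
    H.IsWalk B p x y := by
  induction p generalizing x with
  | nil => exact h
  | cons a p ih =>
    obtain ⟨ha, hp⟩ := List.forall_mem_cons.1 hB
    exact ⟨ha, by rw [hsrc]; exact h.2.1, by rw [htgt]; exact ih h.2.2 hp⟩

theorem IsWalk.end_mem {p : List ε} {x y : V} (h : G.IsWalk A p x y) :
    y ∈ x :: p.map G.tgt := by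
  induction p generalizing x with
  | nil => exact List.mem_singleton.2 h.symm
  | cons a p ih => exact List.mem_cons_of_mem _ (ih h.2.2)

theorem IsWalk.src_mem {p : List ε} {x y : V} (h : G.IsWalk A p x y) :
    ∀ e ∈ p, G.src e ∈ x :: p.map G.tgt := by
  induction p generalizing x with
  | nil => simp
  | cons a p ih =>
    refine List.forall_mem_cons.2 ⟨by simp [h.2.1], fun e he => ?_⟩
    exact List.mem_cons_of_mem _ (ih h.2.2 e he)

/-- Every source of an edge of a cycle is also the target of an edge of the cycle. -/
theorem IsCycle.src_mem {p : List ε} {x : V} (h : G.IsCycle A p x) :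
    ∀ e ∈ p, G.src e ∈ p.map G.tgt := by
  obtain ⟨hne, hw, -⟩ := h
  have hx : x ∈ p.map G.tgt := by
    cases p with
    | nil => exact absurd rfl hne
    | cons a p => exact hw.2.2.end_mem
  intro e he
  rcases List.mem_cons.1 (hw.src_mem e he) with h | h
  · exact h ▸ hx
  · exact h

end Walks

variable {V : Type*} {ε : Type*} {G : MultiDigraph V ε}

/-- An edge entering the dominated set `dom_G(u)` from outside has target `u`. -/
theorem tgt_eq_of_src_notMem_domSet (hwf : G.WellFormed) {v u : V} {e : ε}
    (he : e ∈ G.edges) (hsrc : G.src e ∉ G.domSet v u) (htgt : G.tgt e ∈ G.domSet v u) :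
    G.tgt e = u := by
  classical
  simp only [domSet, Finset.mem_filter, not_and] at hsrc htgt
  have hnd := hsrc (hwf e he).1
  simp only [Dominates, not_forall] at hnd
  obtain ⟨p, hp, hup⟩ := hnd
  by_cases hmem : G.tgt e ∈ v :: p.map G.tgt
  · obtain ⟨q, hq, hw⟩ := hp.1.exists_prefix hmem
    have hsub : (v :: q.map G.tgt).Sublist (v :: p.map G.tgt) := (hq.sublist.map _).cons_cons _
    exact absurd (hsub.subset (htgt.2 q ⟨hw, hp.2.sublist hsub⟩)) hup
  · have hpath : G.IsPath G.edges (p ++ [e]) v (G.tgt e) := by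
      refine ⟨hp.1.append_edge he rfl, ?_⟩
      rw [List.map_append, ← List.cons_append]
      refine List.Nodup.append hp.2 (by simp) ?_
      simpa using hmem
    have hu := htgt.2 _ hpath
    rw [List.map_append, ← List.cons_append] at hu
    rcases List.mem_append.1 hu with hu | hu
    · exact absurd hu hup
    · exact (List.mem_singleton.1 hu).symm

variable [DecidableEq V]

/-- If edges enter `S` only at `u`, then discarding the edges of a walk that do not survive
the contraction `G(S → u)` leaves a walk of the contraction. -/
theorem IsWalk.filter_contract [DecidableEq ε] {S : Finset V} {u : V}
    (hS : ∀ e ∈ G.edges, G.src e ∉ S → G.tgt e ∈ S → G.tgt e = u)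
    {p : List ε} {x y : V} (h : G.IsWalk G.edges p x y) :
    (G.contract S u).IsWalk (G.contract S u).edges
      (p.filter (fun e => e ∈ (G.contract S u).edges))
      (if x ∈ S then u else x) (if y ∈ S then u else y) := by
  induction p generalizing x with
  | nil =>
    obtain rfl : x = y := h
    rfl
  | cons a p ih =>
    obtain ⟨ha, rfl, hw⟩ := h
    by_cases hmem : a ∈ (G.contract S u).edges
    · rw [List.filter_cons_of_pos (by simpa using hmem)]
      exact ⟨hmem, rfl, ih hw⟩
    · rw [List.filter_cons_of_neg (by simpa using hmem)]
      simp only [contract, Finset.mem_filter, not_and, not_or, not_not] at hmem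
      obtain ⟨htgt, hsrc⟩ := hmem ha
      have hsrc : G.src a ∈ S := by
        by_contra hn
        exact hsrc hn (hS a ha hn htgt)
      have := ih hw
      rw [if_pos htgt] at this
      rwa [if_pos hsrc]

theorem contract_tgt_of_mem_edges {S : Finset V} {u : V} {e : ε}
    (he : e ∈ (G.contract S u).edges) : (G.contract S u).tgt e = G.tgt e := by
  simp only [contract, Finset.mem_filter] at he ⊢
  split_ifs with h
  · exact (he.2.resolve_left (not_not.2 h)).2.symm
  · rfl

end MultiDigraph

/-- For `G` rooted at `v`, `u ∈ V`, `D = dom_G(u)`: every simple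
directed cycle of `G` whose edge into `u` (if any) comes from outside `D` either lies
entirely within `G[D∖{u}]` — and hence is a cycle of `root_u(G[D])` — or corresponds to
a directed cycle of the contracted digraph `G(D → u)`. -/
theorem statement_17 (G : MultiDigraph V ε) (hwf : G.WellFormed) (hsimple : G.Simple)
    (v : V) (hroot : G.RootedAt v) (u : V) (hu : u ∈ G.verts)
    (p : List ε) (x : V) (hcyc : G.IsCycle G.edges p x)
    (hcon : ∀ e ∈ p, G.tgt e = u → G.src e ∉ G.domSet v u) :
    ((∀ e ∈ p, G.src e ∈ (G.domSet v u).erase u ∧ G.tgt e ∈ (G.domSet v u).erase u) ∧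
      ((G.induce (G.domSet v u)).rootAt u).IsCycle
        ((G.induce (G.domSet v u)).rootAt u).edges p x) ∨
    ∃ q y, (G.contract (G.domSet v u) u).IsCycle
        (G.contract (G.domSet v u) u).edges q y ∧ ∀ e ∈ q, e ∈ p := by
  classical
  by_cases hin : ∀ e ∈ p, G.tgt e ∈ G.domSet v u
  · left
    have hsrc : ∀ e ∈ p, G.src e ∈ G.domSet v u := fun e he => by
      obtain ⟨f, hf, hfe⟩ := List.mem_map.1 (hcyc.src_mem e he)
      exact hfe ▸ hin f hf
    have htu : ∀ e ∈ p, G.tgt e ≠ u := fun e he h => hcon e he h (hsrc e he)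
    have hsu : ∀ e ∈ p, G.src e ≠ u := fun e he => by
      obtain ⟨f, hf, hfe⟩ := List.mem_map.1 (hcyc.src_mem e he)
      exact hfe ▸ htu f hf
    refine ⟨fun e he => ⟨Finset.mem_erase.2 ⟨hsu e he, hsrc e he⟩,
      Finset.mem_erase.2 ⟨htu e he, hin e he⟩⟩, hcyc.1,
      hcyc.2.1.mono rfl rfl fun e he => ?_, hcyc.2.2⟩
    exact Finset.mem_filter.2 ⟨Finset.mem_filter.2
      ⟨hcyc.2.1.subset e he, hsrc e he, hin e he⟩, htu e he⟩
  · right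
    push Not at hin
    obtain ⟨e, he, hout⟩ := hin
    have hmem : e ∈ (G.contract (G.domSet v u) u).edges :=
      Finset.mem_filter.2 ⟨hcyc.2.1.subset e he, Or.inl hout⟩
    refine ⟨_, _, ⟨List.ne_nil_of_mem (List.mem_filter.2 ⟨he, by simpa using hmem⟩),
      hcyc.2.1.filter_contract fun f hf =>
        MultiDigraph.tgt_eq_of_src_notMem_domSet hwf hf, ?_⟩,
      fun f hf => List.mem_of_mem_filter hf⟩
    rw [List.map_congr_left fun f hf => MultiDigraph.contract_tgt_of_mem_edges
      (by simpa using (List.mem_filter.1 hf).2)]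
    exact hcyc.2.2.sublist (List.filter_sublist.map _)
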